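/- arXiv:2110.09133 — 5 statements merged into one kernel-verified Lean document; each statement's English description precedes it below -/
import Mathlib

section
/- For each k ∈ {1,…,K}, let ν_k and ν̃_k be probability measures on ℝ with finite means m_k and m̃_k satisfying m_k < θ < m̃_k, and let a_1,…,a_K > 0. For S ⊆ {1,…,K}, let μ_S denote the bandit instance in which arm k has distribution ν̃_k if k ∈ S and ν_k otherwise. Then for any deterministic sequential algorithm with budget T, sup over S ⊆ {1,…,K} of E_{μ_S}[L_T] ≥ (1/4)·min over all N ∈ ℝ_{≥0}^K with ∑_{k=1}^K N_k = T of ∑_{k=1}^K a_k·exp(−N_k·max{KL(ν_k‖ν̃_k), KL(ν̃_k‖ν_k)}), where KL denotes the Kullback–Leibler divergence with values in [0,∞] and exp(−N·∞) is interpreted as 0 for N > 0. -/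
open MeasureTheory ProbabilityTheory Finset
open scoped ENNReal

/-- A deterministic sequential bandit algorithm with budget `T` on `K` arms: a measurable
pulling rule `pull t : ℝ^t → [K]` giving the arm pulled at round `t+1` as a function of the
`t` previously observed samples, and a measurable sign prediction
`pred : ℝ^T → [K] → Bool` (`true` encoding sign `+1`, i.e. `μ_k > θ`). -/
structure BanditAlg (K T : ℕ) where
  pull : (t : ℕ) → (Fin t → ℝ) → Fin K
  pull_meas : ∀ t, Measurable (pull t)
  pred : (Fin T → ℝ) → Fin K → Bool
  pred_meas : Measurable pred

namespace BanditAlg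

variable {K T : ℕ}

/-- Exogenous randomness: a `T × K` table `ω` where `ω t k` is the sample obtained if arm `k`
is pulled at round `t+1`; rows are extended by `0` beyond `T`. -/
def ext (ω : Fin T → Fin K → ℝ) : ℕ → Fin K → ℝ :=
  fun t => if h : t < T then ω ⟨t, h⟩ else fun _ => 0

/-- History of the first `t` observed samples. -/
def hist (A : BanditAlg K T) (ω : Fin T → Fin K → ℝ) : (t : ℕ) → Fin t → ℝ
  | 0 => fun i => i.elim0
  | t + 1 => Fin.snoc (A.hist ω t) (ext ω t (A.pull t (A.hist ω t)))

/-- Arm pulled at round `t+1`. -/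
def armAt (A : BanditAlg K T) (ω : Fin T → Fin K → ℝ) (t : ℕ) : Fin K :=
  A.pull t (A.hist ω t)

/-- `N_{k,T}`: number of pulls of arm `k` during the `T` rounds. -/
def pulls (A : BanditAlg K T) (ω : Fin T → Fin K → ℝ) (k : Fin K) : ℕ :=
  ((Finset.range T).filter fun t => A.armAt ω t = k).card

/-- Weighted number of sign errors `L_T = ∑_k a_k 1{ŝ_k ≠ sign(μ_k − θ)}`. -/
noncomputable def loss (A : BanditAlg K T) (a μ : Fin K → ℝ) (θ : ℝ)
    (ω : Fin T → Fin K → ℝ) : ℝ :=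
  ∑ k, a k * (if A.pred (A.hist ω T) k = decide (θ < μ k) then 0 else 1)

/-- Law of the exogenous randomness when arm `k` has distribution `ν k`: since each round
uses a fresh independent row of samples, the observed samples have the law of the sequential
bandit interaction. -/
noncomputable def traj (ν : Fin K → Measure ℝ) (hν : ∀ k, IsProbabilityMeasure (ν k)) :
    Measure (Fin T → Fin K → ℝ) :=
  haveI := hν
  Measure.pi fun _ : Fin T => Measure.pi ν

end BanditAlg

/-- Kullback–Leibler divergence, with value `+∞` when `μ` is not absolutely continuous
with respect to `ν` or the log-likelihood ratio is not integrable. -/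
noncomputable def klDiv (μ ν : MeasureTheory.Measure ℝ) : ℝ≥0∞ :=
  letI := Classical.propDecidable
    (μ ≪ ν ∧ MeasureTheory.Integrable (MeasureTheory.llr μ ν) μ)
  if μ ≪ ν ∧ MeasureTheory.Integrable (MeasureTheory.llr μ ν) μ
  then ENNReal.ofReal (∫ x, MeasureTheory.llr μ ν x ∂μ) else ⊤

/-- `exp(−N·c)` for `c ∈ [0,∞]`, with `exp(−N·∞) = 0` for `N > 0` (and `= 1` for `N = 0`). -/
noncomputable def expNegMul (N : ℝ) (c : ℝ≥0∞) : ℝ :=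
  if c = ⊤ then (if N = 0 then 1 else 0) else Real.exp (-(N * c.toReal))

namespace BanditAlg

variable {K T : ℕ}

lemma measurable_ext : Measurable (fun p : (Fin T → Fin K → ℝ) × Fin K => fun t => ext p.1 t p.2) := by
  refine measurable_pi_lambda _ fun t => measurable_from_prod_countable_left fun k => ?_
  by_cases h : t < T
  · simp only [ext, h, dif_pos]
    fun_prop
  · simp only [ext, h, dif_neg, not_false_eq_true]
    fun_prop

lemma measurable_snoc (t : ℕ) :
    Measurable fun p : (Fin t → ℝ) × ℝ => (Fin.snoc p.1 p.2 : Fin (t + 1) → ℝ) := by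
  refine measurable_pi_lambda _ fun i => ?_
  refine Fin.lastCases ?_ (fun j => ?_) i
  · simpa using measurable_snd
  · simp only [Fin.snoc_castSucc]
    fun_prop

lemma measurable_hist (A : BanditAlg K T) (t : ℕ) : Measurable fun ω => A.hist ω t := by
  induction t with
  | zero => exact measurable_const
  | succ t ih =>
    have h := (measurable_pi_apply t).comp
      (measurable_ext.comp (measurable_id.prodMk ((A.pull_meas t).comp ih)))
    exact (measurable_snoc t).comp (ih.prodMk h)

lemma hist_congr (A : BanditAlg K T) {ω ω' : Fin T → Fin K → ℝ} (t : ℕ)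
    (h : ∀ i : Fin T, i.val < t → ω i = ω' i) : A.hist ω t = A.hist ω' t := by
  induction t with
  | zero => rfl
  | succ t ih =>
    have hext : ext ω t = ext ω' t := by
      by_cases ht : t < T
      · simp [ext, ht, h ⟨t, ht⟩ (Nat.lt_succ_self t)]
      · simp [ext, ht]
    simp only [hist, ih fun i hi => h i (hi.trans (Nat.lt_succ_self t)), hext]

/-- Law of the first `t` observed samples. -/
noncomputable def histLaw (A : BanditAlg K T) (ρ : Fin K → Measure ℝ)
    [hρ : ∀ k, IsProbabilityMeasure (ρ k)] (t : ℕ) : Measure (Fin t → ℝ) :=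
  (traj (T := T) ρ hρ).map fun ω => A.hist ω t

/-- Conditional law of the next sample given the history. -/
noncomputable def sampleKernel (A : BanditAlg K T) (ρ : Fin K → Measure ℝ) (t : ℕ) :
    Kernel (Fin t → ℝ) ℝ where
  toFun h := ρ (A.pull t h)
  measurable' := (Measurable.of_discrete (f := ρ)).comp (A.pull_meas t)

lemma sampleKernel_apply (A : BanditAlg K T) (ρ : Fin K → Measure ℝ) (t : ℕ) (h : Fin t → ℝ) :
    A.sampleKernel ρ t h = ρ (A.pull t h) := rfl

section Law

variable (A : BanditAlg K T) (ρ : Fin K → Measure ℝ) [hρ : ∀ k, IsProbabilityMeasure (ρ k)]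

instance : IsProbabilityMeasure (traj (T := T) ρ hρ) := by
  unfold traj; infer_instance

instance (t : ℕ) : IsProbabilityMeasure (A.histLaw ρ t) :=
  Measure.isProbabilityMeasure_map (A.measurable_hist t).aemeasurable

instance (t : ℕ) : IsMarkovKernel (A.sampleKernel ρ t) :=
  ⟨fun h => hρ (A.pull t h)⟩

lemma histLaw_zero : A.histLaw ρ 0 = Measure.dirac default := by
  rw [histLaw, show (fun ω => A.hist ω 0) = fun _ => default from
    funext fun _ => Subsingleton.elim _ _, Measure.map_const]
  simp

lemma indepFun_hist_row {t : ℕ} (ht : t < T) :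
    IndepFun (fun ω => A.hist ω t) (fun ω : Fin T → Fin K → ℝ => ω ⟨t, ht⟩) (traj ρ hρ) := by
  have hi : iIndepFun (fun (i : Fin T) (ω : Fin T → Fin K → ℝ) => ω i) (traj ρ hρ) :=
    iIndepFun_pi (X := fun _ x => x) (fun _ => aemeasurable_id)
  have h := hi.indepFun_finset (univ.filter fun i : Fin T => i.val < t) {⟨t, ht⟩}
    (by simp) (fun i => measurable_pi_apply i)
  let extend : ((univ.filter fun i : Fin T => i.val < t) → Fin K → ℝ) → Fin T → Fin K → ℝ :=
    fun r i => if hi : i.val < t then r ⟨i, by simpa using hi⟩ else 0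
  have hextend : Measurable extend := by
    refine measurable_pi_lambda _ fun i => ?_
    by_cases hi : i.val < t
    · simp only [extend, hi, dif_pos]
      fun_prop
    · simp only [extend, hi, dif_neg, not_false_eq_true]
      fun_prop
  have h' := h.comp ((A.measurable_hist t).comp hextend)
    (measurable_pi_apply (⟨⟨t, ht⟩, by simp⟩ : ({⟨t, ht⟩} : Finset (Fin T))))
  convert h' using 1
  · ext1 ω
    refine A.hist_congr t fun i hi => ?_
    simp [extend, hi]
  · rfl

lemma map_row {t : ℕ} (ht : t < T) :
    (traj ρ hρ).map (fun ω : Fin T → Fin K → ℝ => ω ⟨t, ht⟩) = Measure.pi ρ :=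
  (measurePreserving_eval (fun _ : Fin T => Measure.pi ρ) ⟨t, ht⟩).map_eq

/-- One-step disintegration of the law of the history. -/
lemma histLaw_succ {t : ℕ} (ht : t < T) :
    A.histLaw ρ (t + 1) = (A.histLaw ρ t ⊗ₘ A.sampleKernel ρ t).map
      (fun p => (Fin.snoc p.1 p.2 : Fin (t + 1) → ℝ)) := by
  have hind := (indepFun_iff_map_prod_eq_prod_map_map (A.measurable_hist t).aemeasurable
    (measurable_pi_apply (⟨t, ht⟩ : Fin T)).aemeasurable).1 (A.indepFun_hist_row ρ ht)
  rw [map_row ρ ht] at hind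
  have hstep : Measurable fun p : (Fin t → ℝ) × (Fin K → ℝ) => (p.1, p.2 (A.pull t p.1)) := by
    have hev : Measurable fun q : (Fin K → ℝ) × Fin K => q.1 q.2 :=
      measurable_from_prod_countable_left fun k => measurable_pi_apply k
    exact measurable_fst.prodMk
      (hev.comp (measurable_snd.prodMk ((A.pull_meas t).comp measurable_fst)))
  have hpair : Measurable fun ω : Fin T → Fin K → ℝ => (A.hist ω t, ω ⟨t, ht⟩) :=
    (A.measurable_hist t).prodMk (measurable_pi_apply _)
  have hsplit : (fun ω => A.hist ω (t + 1)) =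
      (fun p : (Fin t → ℝ) × ℝ => (Fin.snoc p.1 p.2 : Fin (t + 1) → ℝ)) ∘
        (fun p : (Fin t → ℝ) × (Fin K → ℝ) => (p.1, p.2 (A.pull t p.1))) ∘
        (fun ω : Fin T → Fin K → ℝ => (A.hist ω t, ω ⟨t, ht⟩)) := by
    ext1 ω
    simp [hist, ext, ht]
  rw [histLaw, hsplit, ← Measure.map_map (measurable_snoc t) (hstep.comp hpair),
    ← Measure.map_map hstep hpair, hind]
  congr 1
  refine Measure.ext_of_lintegral _ fun g hg => ?_
  rw [lintegral_map hg hstep,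
    lintegral_prod (fun p : (Fin t → ℝ) × (Fin K → ℝ) => g (p.1, p.2 (A.pull t p.1)))
      (hg.comp hstep).aemeasurable,
    Measure.lintegral_compProd hg]
  refine lintegral_congr fun h => ?_
  exact (measurePreserving_eval ρ (A.pull t h)).lintegral_comp
    (hg.comp (measurable_const.prodMk measurable_id))

lemma lintegral_histLaw_succ {t : ℕ} (ht : t < T) {g : (Fin (t + 1) → ℝ) → ℝ≥0∞}
    (hg : Measurable g) :
    ∫⁻ h, g h ∂A.histLaw ρ (t + 1) =
      ∫⁻ h, ∫⁻ x, g (Fin.snoc h x) ∂ρ (A.pull t h) ∂A.histLaw ρ t := by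
  rw [histLaw_succ A ρ ht, lintegral_map hg (measurable_snoc t),
    Measure.lintegral_compProd (f := fun p => g (Fin.snoc p.1 p.2)) (hg.comp (measurable_snoc t))]
  rfl

/-- Expected number of pulls of arm `k` during the first `t` rounds. -/
noncomputable def expectedPulls (k : Fin K) (t : ℕ) : ℝ :=
  ∑ i ∈ range t, (A.histLaw ρ i).real {h | A.pull i h = k}

lemma expectedPulls_succ (k : Fin K) (t : ℕ) : A.expectedPulls ρ k (t + 1) =
    A.expectedPulls ρ k t + (A.histLaw ρ t).real {h | A.pull t h = k} :=
  sum_range_succ _ _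

lemma expectedPulls_nonneg (k : Fin K) (t : ℕ) : 0 ≤ A.expectedPulls ρ k t :=
  Finset.sum_nonneg fun _ _ => measureReal_nonneg

lemma measurableSet_pull_eq (k : Fin K) (t : ℕ) : MeasurableSet {h | A.pull t h = k} :=
  A.pull_meas t (measurableSet_singleton k)

lemma sum_expectedPulls (t : ℕ) : ∑ k, A.expectedPulls ρ k t = t := by
  simp only [expectedPulls]
  rw [Finset.sum_comm]
  have (i : ℕ) : ∑ k, (A.histLaw ρ i).real {h | A.pull i h = k} = 1 := by
    have := sum_measureReal_preimage_singleton (μ := A.histLaw ρ i) (f := A.pull i) univ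
      (fun k _ => A.measurableSet_pull_eq k i)
    simpa [Set.preimage] using this
  simp [this]

end Law

/-- Log-likelihood ratio accumulated along a history, `ℓ k` being the one of arm `k`. -/
noncomputable def cumLLR (A : BanditAlg K T) (ℓ : Fin K → ℝ → ℝ) : (t : ℕ) → (Fin t → ℝ) → ℝ
  | 0, _ => 0
  | t + 1, h => A.cumLLR ℓ t (Fin.init h) + ℓ (A.pull t (Fin.init h)) (h (Fin.last t))

section LLR

variable (A : BanditAlg K T) {ℓ : Fin K → ℝ → ℝ}

lemma cumLLR_snoc (t : ℕ) (h : Fin t → ℝ) (x : ℝ) :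
    A.cumLLR ℓ (t + 1) (Fin.snoc h x) = A.cumLLR ℓ t h + ℓ (A.pull t h) x := by
  simp [cumLLR]

lemma measurable_uncurry_pull (hℓ : ∀ k, Measurable (ℓ k)) (t : ℕ) :
    Measurable fun p : (Fin t → ℝ) × ℝ => ℓ (A.pull t p.1) p.2 :=
  (measurable_from_prod_countable_right (f := fun q : Fin K × ℝ => ℓ q.1 q.2) hℓ).comp
    (((A.pull_meas t).comp measurable_fst).prodMk measurable_snd)

lemma measurable_cumLLR (hℓ : ∀ k, Measurable (ℓ k)) (t : ℕ) : Measurable (A.cumLLR ℓ t) := by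
  induction t with
  | zero => exact measurable_const
  | succ t ih =>
    have hinit : Measurable fun h : Fin (t + 1) → ℝ => (Fin.init h : Fin t → ℝ) :=
      measurable_pi_lambda _ fun i => measurable_pi_apply _
    exact (ih.comp hinit).add
      ((A.measurable_uncurry_pull hℓ t).comp (hinit.prodMk (measurable_pi_apply _)))

/-- Change of measure for the law of the history. -/
lemma histLaw_eq_withDensity (ρ ρ' : Fin K → Measure ℝ) [∀ k, IsProbabilityMeasure (ρ k)]
    [∀ k, IsProbabilityMeasure (ρ' k)] (hℓ : ∀ k, Measurable (ℓ k))
    (hρ : ∀ k, ρ' k = (ρ k).withDensity fun x => ENNReal.ofReal (Real.exp (-ℓ k x)))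
    {t : ℕ} (ht : t ≤ T) :
    A.histLaw ρ' t =
      (A.histLaw ρ t).withDensity fun h => ENNReal.ofReal (Real.exp (-A.cumLLR ℓ t h)) := by
  induction t with
  | zero =>
    simp [histLaw_zero, cumLLR]
  | succ t ih =>
    have hlt : t < T := ht
    have hm (s : ℕ) : Measurable fun h => ENNReal.ofReal (Real.exp (-A.cumLLR ℓ s h)) :=
      (A.measurable_cumLLR hℓ s).neg.exp.ennreal_ofReal
    have hmℓ (k : Fin K) : Measurable fun x => ENNReal.ofReal (Real.exp (-ℓ k x)) :=
      (hℓ k).neg.exp.ennreal_ofReal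
    refine Measure.ext_of_lintegral _ fun g hg => ?_
    have hgs (h : Fin t → ℝ) : Measurable fun x => g (Fin.snoc h x) :=
      hg.comp ((measurable_snoc t).comp (measurable_const.prodMk measurable_id))
    have hinner : Measurable fun h => ∫⁻ x, g (Fin.snoc h x) ∂ρ' (A.pull t h) :=
      (hg.comp (measurable_snoc t)).lintegral_kernel_prod_right' (κ := A.sampleKernel ρ' t)
    rw [lintegral_histLaw_succ A ρ' hlt hg, ih hlt.le,
      lintegral_withDensity_eq_lintegral_mul _ (hm t) hinner,
      lintegral_withDensity_eq_lintegral_mul _ (hm (t + 1)) hg,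
      lintegral_histLaw_succ A ρ hlt ((hm (t + 1)).mul hg)]
    refine lintegral_congr fun h => ?_
    simp only [Pi.mul_apply]
    rw [hρ, lintegral_withDensity_eq_lintegral_mul _ (hmℓ _) (hgs h),
      ← lintegral_const_mul _ ((hmℓ _).mul (hgs h))]
    refine lintegral_congr fun x => ?_
    simp only [Pi.mul_apply]
    rw [cumLLR_snoc, neg_add, Real.exp_add, ENNReal.ofReal_mul (Real.exp_pos _).le, mul_assoc]

lemma integrable_cumLLR (ρ : Fin K → Measure ℝ) [∀ k, IsProbabilityMeasure (ρ k)]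
    (hℓ : ∀ k, Measurable (ℓ k)) (hi : ∀ k, Integrable (ℓ k) (ρ k)) {t : ℕ} (ht : t ≤ T) :
    Integrable (A.cumLLR ℓ t) (A.histLaw ρ t) ∧
      ∫ h, A.cumLLR ℓ t h ∂A.histLaw ρ t = ∑ k, A.expectedPulls ρ k t * ∫ x, ℓ k x ∂ρ k := by
  induction t with
  | zero => simp [cumLLR, expectedPulls]
  | succ t ih =>
    have hlt : t < T := ht
    obtain ⟨ihi, ihe⟩ := ih hlt.le
    have hstep := A.measurable_uncurry_pull hℓ t
    have hbdd (F : Fin K → ℝ) : Integrable (fun h => F (A.pull t h)) (A.histLaw ρ t) :=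
      Integrable.of_bound ((Measurable.of_discrete (f := F)).comp
        (A.pull_meas t)).aestronglyMeasurable (∑ k, ‖F k‖) (ae_of_all _ fun h =>
          Finset.single_le_sum (f := fun k => ‖F k‖) (fun _ _ => norm_nonneg _) (mem_univ _))
    have hi1 : Integrable (fun p : (Fin t → ℝ) × ℝ => A.cumLLR ℓ t p.1)
        (A.histLaw ρ t ⊗ₘ A.sampleKernel ρ t) := by
      have h := Measure.fst_compProd (A.histLaw ρ t) (A.sampleKernel ρ t)
      rw [← h, Measure.fst] at ihi
      exact ihi.comp_measurable measurable_fst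
    have hi2 : Integrable (fun p : (Fin t → ℝ) × ℝ => ℓ (A.pull t p.1) p.2)
        (A.histLaw ρ t ⊗ₘ A.sampleKernel ρ t) := by
      rw [Measure.integrable_compProd_iff hstep.aestronglyMeasurable]
      exact ⟨ae_of_all _ fun h => hi _, hbdd fun k => ∫ x, ‖ℓ k x‖ ∂ρ k⟩
    have hsum : (fun p : (Fin t → ℝ) × ℝ => A.cumLLR ℓ (t + 1) (Fin.snoc p.1 p.2)) =
        fun p => A.cumLLR ℓ t p.1 + ℓ (A.pull t p.1) p.2 :=
      funext fun p => A.cumLLR_snoc t p.1 p.2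
    have hmeas := (A.measurable_cumLLR hℓ (t + 1)).aestronglyMeasurable
      (μ := (A.histLaw ρ t ⊗ₘ A.sampleKernel ρ t).map
        fun p => (Fin.snoc p.1 p.2 : Fin (t + 1) → ℝ))
    rw [histLaw_succ A ρ hlt]
    constructor
    · rw [integrable_map_measure hmeas (measurable_snoc t).aemeasurable]
      exact (hi1.add hi2).congr (ae_of_all _ fun p => (A.cumLLR_snoc t p.1 p.2).symm)
    · rw [integral_map (measurable_snoc t).aemeasurable hmeas, hsum, integral_add hi1 hi2,
        Measure.integral_compProd hi1, Measure.integral_compProd hi2]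
      have hdecomp (h : Fin t → ℝ) : ∫ x, ℓ (A.pull t h) x ∂ρ (A.pull t h) =
          ∑ k, {h | A.pull t h = k}.indicator (fun _ => ∫ x, ℓ k x ∂ρ k) h := by
        simp [Set.indicator_apply]
      simp only [sampleKernel_apply, integral_const, probReal_univ, one_smul, hdecomp]
      rw [integral_finsetSum _ fun k _ =>
        (integrable_const _).indicator (A.measurableSet_pull_eq k t), ihe, ← sum_add_distrib]
      refine Finset.sum_congr rfl fun k _ => ?_
      rw [integral_indicator_const _ (A.measurableSet_pull_eq k t), expectedPulls_succ,
        smul_eq_mul]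
      ring

end LLR

/-- If arm `k` is almost surely never pulled, its distribution does not affect the history. -/
lemma histLaw_eq_of_expectedPulls_eq_zero (A : BanditAlg K T) (ρ ρ' : Fin K → Measure ℝ)
    [∀ k, IsProbabilityMeasure (ρ k)] [∀ k, IsProbabilityMeasure (ρ' k)] (k : Fin K)
    (hne : ∀ j, j ≠ k → ρ' j = ρ j) {t : ℕ} (ht : t ≤ T) (h0 : A.expectedPulls ρ k t = 0) :
    A.histLaw ρ' t = A.histLaw ρ t := by
  induction t with
  | zero => rw [histLaw_zero, histLaw_zero]
  | succ t ih =>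
    have hlt : t < T := ht
    rw [expectedPulls_succ, add_eq_zero_iff_of_nonneg
      (A.expectedPulls_nonneg ρ k t) measureReal_nonneg] at h0
    refine Measure.ext_of_lintegral _ fun g hg => ?_
    rw [lintegral_histLaw_succ A ρ' hlt hg, lintegral_histLaw_succ A ρ hlt hg, ih hlt.le h0.1]
    have hae : ∀ᵐ h ∂A.histLaw ρ t, A.pull t h ≠ k := by
      rw [ae_iff]
      simpa [measureReal_eq_zero_iff] using h0.2
    refine lintegral_congr_ae ?_
    filter_upwards [hae] with h hh
    rw [hne _ hh]

end BanditAlg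

/-- **Bretagnolle–Huber inequality** for `Q = exp (-L) P`. -/
lemma bretagnolle_huber {Ω : Type*} [MeasurableSpace Ω] (P Q : Measure Ω)
    [IsProbabilityMeasure P] [IsProbabilityMeasure Q] {L : Ω → ℝ} (hL : Measurable L)
    (hLi : Integrable L P) (hQ : Q = P.withDensity fun ω => ENNReal.ofReal (Real.exp (-L ω)))
    {E : Set Ω} (hE : MeasurableSet E) :
    1 / 2 * Real.exp (-∫ ω, L ω ∂P) ≤ P.real E + Q.real Eᶜ := by
  set m := ∫ ω, L ω ∂P with hm
  have hQreal {B : Set Ω} (hB : MeasurableSet B) :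
      Q B = ∫⁻ ω in B, ENNReal.ofReal (Real.exp (-L ω)) ∂P := by
    rw [hQ, withDensity_apply _ hB]
  have hexp : Integrable (fun ω => Real.exp (-L ω)) P := by
    refine ⟨hL.neg.exp.aestronglyMeasurable, ?_⟩
    rw [hasFiniteIntegral_iff_ofReal (ae_of_all _ fun ω => (Real.exp_pos _).le)]
    have := hQreal MeasurableSet.univ
    rw [measure_univ, setLIntegral_univ] at this
    simp [← this]
  have hQint {B : Set Ω} (hB : MeasurableSet B) :
      ∫ ω in B, Real.exp (-L ω) ∂P = Q.real B := by
    rw [integral_eq_lintegral_of_nonneg_ae (ae_of_all _ fun ω => (Real.exp_pos _).le)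
      hexp.aestronglyMeasurable.restrict, measureReal_def, hQreal hB]
  have hlow : Real.exp (-m / 2) ≤ ∫ ω, Real.exp (-m / 2) * (1 - (L ω - m) / 2) ∂P := by
    rw [integral_const_mul, integral_sub (integrable_const _) (by fun_prop), integral_div,
      integral_sub hLi (integrable_const _)]
    simp [← hm]
  set e := Real.exp (-m / 2) with he
  have he0 : 0 < e := Real.exp_pos _
  have hpt (ω : Ω) : e * (1 - (L ω - m) / 2) ≤ Real.exp (-L ω / 2) := by
    have h1 := Real.add_one_le_exp (-(L ω - m) / 2)
    calc e * (1 - (L ω - m) / 2) ≤ e * Real.exp (-(L ω - m) / 2) := by gcongr; linarith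
      _ = _ := by rw [he, ← Real.exp_add]; ring_nf
  have hsq (ω : Ω) : Real.exp (-L ω) = Real.exp (-L ω / 2) ^ 2 := by
    rw [← Real.exp_nat_mul]; ring_nf
  have hamE (ω : Ω) : Real.exp (-L ω / 2) ≤ 1 / e + e / 4 * Real.exp (-L ω) := by
    rw [hsq]
    have : 1 / e + e / 4 * Real.exp (-L ω / 2) ^ 2 - Real.exp (-L ω / 2)
        = (1 - e * Real.exp (-L ω / 2) / 2) ^ 2 / e := by field_simp; ring
    have : 0 ≤ (1 - e * Real.exp (-L ω / 2) / 2) ^ 2 / e := by positivity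
    linarith
  have hamEc (ω : Ω) : Real.exp (-L ω / 2) ≤ e / 4 + 1 / e * Real.exp (-L ω) := by
    rw [hsq]
    have : e / 4 + 1 / e * Real.exp (-L ω / 2) ^ 2 - Real.exp (-L ω / 2)
        = (Real.exp (-L ω / 2) - e / 2) ^ 2 / e := by field_simp; ring
    have : 0 ≤ (Real.exp (-L ω / 2) - e / 2) ^ 2 / e := by positivity
    linarith
  have hli : Integrable (fun ω => e * (1 - (L ω - m) / 2)) P := by fun_prop
  have hup : ∫ ω, e * (1 - (L ω - m) / 2) ∂P ≤
      (1 / e * P.real E + e / 4 * Q.real E) + (e / 4 * P.real Eᶜ + 1 / e * Q.real Eᶜ) := by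
    rw [← integral_add_compl hE hli]
    refine add_le_add ?_ ?_
    · calc _ ≤ ∫ ω in E, (1 / e + e / 4 * Real.exp (-L ω)) ∂P :=
            integral_mono hli.integrableOn
              ((integrable_const _).add (hexp.integrableOn.const_mul _))
              fun ω => (hpt ω).trans (hamE ω)
        _ = _ := by
          rw [integral_add (integrable_const _) (hexp.integrableOn.const_mul _),
            integral_const_mul, hQint hE]
          simp [mul_comm]
    · calc _ ≤ ∫ ω in Eᶜ, (e / 4 + 1 / e * Real.exp (-L ω)) ∂P :=
            integral_mono hli.integrableOn
              ((integrable_const _).add (hexp.integrableOn.const_mul _))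
              fun ω => (hpt ω).trans (hamEc ω)
        _ = _ := by
          rw [integral_add (integrable_const _) (hexp.integrableOn.const_mul _),
            integral_const_mul, hQint hE.compl]
          simp [mul_comm]
  have hPE : P.real Eᶜ ≤ 1 := measureReal_le_one
  have hQE : Q.real E ≤ 1 := measureReal_le_one
  have hmain : e ≤ 1 / e * (P.real E + Q.real Eᶜ) + e / 2 := by nlinarith
  have hee : Real.exp (-m) = e * e := by rw [he, ← Real.exp_add]; ring_nf
  rw [hee]
  have : e * (1 / e * (P.real E + Q.real Eᶜ)) = P.real E + Q.real Eᶜ := by field_simp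
  nlinarith

lemma expNegMul_nonneg (N : ℝ) (c : ℝ≥0∞) : 0 ≤ expNegMul N c := by
  unfold expNegMul
  split_ifs <;> positivity

lemma klDiv_ne_top {μ ν : Measure ℝ} (h : klDiv μ ν ≠ ⊤) :
    μ ≪ ν ∧ Integrable (llr μ ν) μ ∧ ∫ x, llr μ ν x ∂μ ≤ (klDiv μ ν).toReal := by
  unfold klDiv at h ⊢
  split_ifs at h ⊢ with hc
  · exact ⟨hc.1, hc.2, by simp [ENNReal.toReal_ofReal']⟩
  · exact absurd rfl h

namespace BanditAlg

variable {K T : ℕ}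

/-- Two-point lower bound for instances that differ only in the distribution of arm `k`. -/
lemma two_point_bound (A : BanditAlg K T) (ρ ρ' : Fin K → Measure ℝ)
    [∀ k, IsProbabilityMeasure (ρ k)] [∀ k, IsProbabilityMeasure (ρ' k)] (k : Fin K)
    (hne : ∀ j, j ≠ k → ρ' j = ρ j) {c : ℝ≥0∞} (hc : klDiv (ρ k) (ρ' k) ≤ c)
    (hc' : klDiv (ρ' k) (ρ k) ≤ c) {E : Set (Fin T → ℝ)} (hE : MeasurableSet E) :
    1 / 2 * expNegMul (A.expectedPulls ρ k T) c ≤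
      (A.histLaw ρ T).real E + (A.histLaw ρ' T).real Eᶜ := by
  by_cases htop : c = ⊤
  · by_cases h0 : A.expectedPulls ρ k T = 0
    · rw [histLaw_eq_of_expectedPulls_eq_zero A ρ ρ' k hne le_rfl h0, probReal_compl_eq_one_sub hE]
      simp only [expNegMul, htop, h0, if_true]
      norm_num
    · simp only [expNegMul, htop, h0, if_true, if_false, mul_zero]
      positivity
  obtain ⟨hac, hint, hle⟩ := klDiv_ne_top (ne_top_of_le_ne_top htop hc)
  obtain ⟨hac', -, -⟩ := klDiv_ne_top (ne_top_of_le_ne_top htop hc')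
  let ℓ : Fin K → ℝ → ℝ := fun j => if j = k then llr (ρ k) (ρ' k) else fun _ => 0
  have hℓ (j : Fin K) : Measurable (ℓ j) := by
    by_cases hj : j = k
    · simpa [ℓ, hj] using measurable_llr _ _
    · simp [ℓ, hj]
  have hℓi (j : Fin K) : Integrable (ℓ j) (ρ j) := by
    by_cases hj : j = k
    · subst hj; simpa [ℓ] using hint
    · simp [ℓ, hj]
  have hdens (j : Fin K) :
      ρ' j = (ρ j).withDensity fun x => ENNReal.ofReal (Real.exp (-ℓ j x)) := by
    by_cases hj : j = k
    · subst hj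
      have : (fun x => ENNReal.ofReal (Real.exp (-ℓ j x))) =ᵐ[ρ j] (ρ' j).rnDeriv (ρ j) := by
        filter_upwards [exp_neg_llr hac, Measure.rnDeriv_lt_top (ρ' j) (ρ j)] with x hx hlt
        simp only [ℓ, if_true, hx, ENNReal.ofReal_toReal hlt.ne]
      rw [withDensity_congr_ae this, Measure.withDensity_rnDeriv_eq _ _ hac']
    · simp [ℓ, hj, hne j hj]
  obtain ⟨hLi, hLe⟩ := A.integrable_cumLLR ρ hℓ hℓi (le_refl T)
  have hBH := bretagnolle_huber _ _ (A.measurable_cumLLR hℓ T) hLi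
    (A.histLaw_eq_withDensity ρ ρ' hℓ hdens le_rfl) hE
  refine le_trans ?_ hBH
  have hsum : ∑ j, A.expectedPulls ρ j T * ∫ x, ℓ j x ∂ρ j =
      A.expectedPulls ρ k T * ∫ x, llr (ρ k) (ρ' k) x ∂ρ k := by
    rw [Finset.sum_eq_single k (fun j _ hj => by simp [ℓ, hj]) (by simp)]
    simp [ℓ]
  rw [hLe, hsum, expNegMul, if_neg htop]
  have := A.expectedPulls_nonneg ρ k T
  have := hle.trans (ENNReal.toReal_mono htop hc)
  gcongr

/-- The expected loss is the weighted sum of the probabilities of sign errors. -/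
lemma integral_loss (A : BanditAlg K T) (a μ : Fin K → ℝ) (θ : ℝ) (ρ : Fin K → Measure ℝ)
    [hρ : ∀ k, IsProbabilityMeasure (ρ k)] :
    ∫ ω, A.loss a μ θ ω ∂traj ρ hρ =
      ∑ k, a k * (A.histLaw ρ T).real {h | A.pred h k = decide (θ < μ k)}ᶜ := by
  have hmeas (k : Fin K) : MeasurableSet {h | A.pred h k = decide (θ < μ k)}ᶜ :=
    (((measurable_pi_apply k).comp A.pred_meas) (measurableSet_singleton _)).compl
  have hpre (k : Fin K) : MeasurableSet
      ((fun ω => A.hist ω T) ⁻¹' {h | A.pred h k = decide (θ < μ k)}ᶜ) :=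
    A.measurable_hist T (hmeas k)
  have hloss : A.loss a μ θ = fun ω => ∑ k, a k *
      ((fun ω => A.hist ω T) ⁻¹' {h | A.pred h k = decide (θ < μ k)}ᶜ).indicator 1 ω := by
    ext ω
    refine Finset.sum_congr rfl fun k _ => ?_
    by_cases h : A.pred (A.hist ω T) k = decide (θ < μ k) <;> simp [h]
  rw [hloss, integral_finsetSum]
  · refine Finset.sum_congr rfl fun k _ => ?_
    rw [integral_const_mul, integral_indicator_one (hpre k), histLaw,
      map_measureReal_apply (A.measurable_hist T) (hmeas k)]
  · exact fun k _ => ((integrable_const (1 : ℝ)).indicator (hpre k)).const_mul _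

end BanditAlg

/-- General lower bound (Theorem 3 in the appendix): for distributions `ν_k` with mean below
`θ` and `ν̃_k` with mean above `θ`, some choice `μ_S` (using `ν̃_k` for `k ∈ S`, `ν_k`
otherwise) forces expected loss at least
`(1/4)·min_{∑N_k=T} ∑_k a_k·exp(−N_k·max{KL(ν_k‖ν̃_k), KL(ν̃_k‖ν_k)})`. -/
theorem stmt1 (K T : ℕ) (hK : 1 ≤ K) (A : BanditAlg K T)
    (a : Fin K → ℝ) (ha : ∀ k, 0 < a k) (θ : ℝ)
    (ν νt : Fin K → MeasureTheory.Measure ℝ)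
    (hν : ∀ k, MeasureTheory.IsProbabilityMeasure (ν k))
    (hνt : ∀ k, MeasureTheory.IsProbabilityMeasure (νt k))
    (m mt : Fin K → ℝ)
    (hint : ∀ k, MeasureTheory.Integrable (fun x => x) (ν k))
    (hintt : ∀ k, MeasureTheory.Integrable (fun x => x) (νt k))
    (hm : ∀ k, ∫ x, x ∂(ν k) = m k) (hmt : ∀ k, ∫ x, x ∂(νt k) = mt k)
    (horder : ∀ k, m k < θ ∧ θ < mt k) :
    (1 / 4 : ℝ) *
        (⨅ N : {N : Fin K → ℝ // (∀ k, 0 ≤ N k) ∧ ∑ k, N k = (T : ℝ)},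
          ∑ k, a k * expNegMul (N.1 k) (max (klDiv (ν k) (νt k)) (klDiv (νt k) (ν k))))
      ≤ ⨆ S : Finset (Fin K),
          ∫ ω, A.loss a (fun k => if k ∈ S then mt k else m k) θ ω
            ∂ BanditAlg.traj (fun k => if k ∈ S then νt k else ν k)
              (fun k => by
                show MeasureTheory.IsProbabilityMeasure (if k ∈ S then νt k else ν k)
                split_ifs with h
                exacts [hνt k, hν k]) := by
  let ρ : Finset (Fin K) → Fin K → Measure ℝ := fun S k => if k ∈ S then νt k else ν k
  have hρ (S : Finset (Fin K)) (k : Fin K) : IsProbabilityMeasure (ρ S k) := by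
    simp only [ρ]
    split_ifs
    exacts [hνt k, hν k]
  let err : Finset (Fin K) → Fin K → Set (Fin T → ℝ) := fun S k =>
    {h | A.pred h k = decide (θ < if k ∈ S then mt k else m k)}ᶜ
  have herr (S : Finset (Fin K)) (k : Fin K) : MeasurableSet (err S k) :=
    (((measurable_pi_apply k).comp A.pred_meas) (measurableSet_singleton _)).compl
  let flip : Fin K → Finset (Fin K) → Finset (Fin K) := fun k S => symmDiff S {k}
  have hflip (k : Fin K) : Function.Involutive (flip k) := fun S => by simp [flip]
  let c : Fin K → ℝ≥0∞ := fun k => max (klDiv (ν k) (νt k)) (klDiv (νt k) (ν k))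
  let R : Finset (Fin K) → ℝ := fun S => ∑ k, a k * (A.histLaw (ρ S) T).real (err S k)
  let G : Finset (Fin K) → ℝ := fun S => ∑ k, a k * expNegMul (A.expectedPulls (ρ S) k T) (c k)
  have hpair (S : Finset (Fin K)) (k : Fin K) :
      1 / 2 * expNegMul (A.expectedPulls (ρ S) k T) (c k) ≤
        (A.histLaw (ρ S) T).real (err S k) +
          (A.histLaw (ρ (flip k S)) T).real (err (flip k S) k) := by
    have hcompl : err (flip k S) k = (err S k)ᶜ := by
      have h1 := (horder k).1.not_gt
      have h2 := (horder k).2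
      ext h
      by_cases hk : k ∈ S <;> simp [err, flip, hk, h1, h2, mem_symmDiff]
    rw [hcompl]
    refine A.two_point_bound (ρ S) (ρ (flip k S)) k (fun j hj => ?_) ?_ ?_ (herr S k)
    · simp [ρ, flip, mem_symmDiff, hj]
    · by_cases hk : k ∈ S <;> simp [ρ, flip, mem_symmDiff, hk, c]
    · by_cases hk : k ∈ S <;> simp [ρ, flip, mem_symmDiff, hk, c]
  have hsum : ∑ S, 1 / 4 * G S ≤ ∑ S, R S := by
    simp only [G, R, Finset.mul_sum]
    rw [Finset.sum_comm, Finset.sum_comm (s := univ (α := Finset (Fin K)))]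
    refine Finset.sum_le_sum fun k _ => ?_
    have hk := Finset.sum_le_sum fun S (_ : S ∈ univ) => hpair S k
    rw [sum_add_distrib, (hflip k).bijective.sum_comp
      (fun S => (A.histLaw (ρ S) T).real (err S k)), ← Finset.mul_sum] at hk
    simp only [mul_left_comm (1 / 4 : ℝ), ← Finset.mul_sum]
    exact mul_le_mul_of_nonneg_left (by linarith) (ha k).le
  obtain ⟨S, -, hS⟩ := Finset.exists_le_of_sum_le univ_nonempty hsum
  calc _ ≤ 1 / 4 * G S := by
        refine mul_le_mul_of_nonneg_left ?_ (by norm_num)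
        refine ciInf_le (f := fun N : {N : Fin K → ℝ // (∀ k, 0 ≤ N k) ∧ ∑ k, N k = (T : ℝ)} =>
          ∑ k, a k * expNegMul (N.1 k) (c k)) ⟨0, ?_⟩
          ⟨fun k => A.expectedPulls (ρ S) k T, fun k => A.expectedPulls_nonneg (ρ S) k T,
            A.sum_expectedPulls (ρ S) T⟩
        rintro _ ⟨N, rfl⟩
        exact Finset.sum_nonneg fun k _ => mul_nonneg (ha k).le (expNegMul_nonneg _ _)
    _ ≤ R S := hS
    _ ≤ _ := by
        have hR : R S = ∫ ω, A.loss a (fun k => if k ∈ S then mt k else m k) θ ω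
            ∂BanditAlg.traj (ρ S) (hρ S) := (A.integral_loss a _ θ (ρ S)).symm
        rw [hR]
        exact le_ciSup (f := fun S : Finset (Fin K) =>
          ∫ ω, A.loss a (fun k => if k ∈ S then mt k else m k) θ ω
            ∂BanditAlg.traj (ρ S) (hρ S)) (Set.finite_range _).bddAbove S
end

section
/- Let K ≥ 1, T > 0, and a_k > 0, Δ_k > 0 for k ∈ {1,…,K} with a_1Δ_1² ≤ a_2Δ_2² ≤ ⋯ ≤ a_KΔ_K². For 1 ≤ k ≤ K define H_k = ∑_{j=k+1}^K (1/Δ_j²)·log(a_jΔ_j²/(a_kΔ_k²)) (so H_K = 0) and set H_0 = +∞. Then: (i) there exists a unique k_0 ∈ {1,…,K} with H_{k_0} < T ≤ H_{k_0−1}; (ii) setting S = {k_0,…,K} and γ = (T + ∑_{j∈S}(1/Δ_j²)·log(1/(a_jΔ_j²)))/(∑_{j∈S} 1/Δ_j²), the vector N* defined by N*_k = 0 for k < k_0 and N*_k = (γ + log(a_kΔ_k²))/Δ_k² for k ∈ S has nonnegative entries, satisfies ∑_{k=1}^K N*_k = T, and minimizes the function N ↦ ∑_{k=1}^K a_k·exp(−N_kΔ_k²)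 over all N ∈ ℝ_{≥0}^K with ∑_{k=1}^K N_k = T. -/
/-- `H_k = ∑_{j>k} (1/Δ_j²)·log(a_jΔ_j²/(a_kΔ_k²))` (0-indexed arms; `H` of the last arm is 0). -/
noncomputable def Hfun {K : ℕ} (a Δ : Fin K → ℝ) (k : Fin K) : ℝ :=
  ∑ j ∈ Finset.univ.filter (fun j => k < j),
    (1 / Δ j ^ 2) * Real.log ((a j * Δ j ^ 2) / (a k * Δ k ^ 2))

/-- The condition `H_{k₀} < T ≤ H_{k₀−1}`, where the second inequality is vacuous for the
first arm (encoding `H_0 = +∞`). -/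
noncomputable def oracleCond {K : ℕ} (a Δ : Fin K → ℝ) (T : ℝ) (k₀ : Fin K) : Prop :=
  Hfun a Δ k₀ < T ∧ ∀ j : Fin K, (j : ℕ) + 1 = (k₀ : ℕ) → T ≤ Hfun a Δ j

/-- The Lagrange-multiplier constant `γ_S(T)` for `S = {k₀,…,K}`. -/
noncomputable def oracleGamma {K : ℕ} (a Δ : Fin K → ℝ) (T : ℝ) (k₀ : Fin K) : ℝ :=
  (T + ∑ j ∈ Finset.univ.filter (fun j => k₀ ≤ j),
      (1 / Δ j ^ 2) * Real.log (1 / (a j * Δ j ^ 2))) /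
    ∑ j ∈ Finset.univ.filter (fun j => k₀ ≤ j), 1 / Δ j ^ 2

/-- The oracle allocation: `N*_k = 0` for `k < k₀` and
`N*_k = (γ + log(a_kΔ_k²))/Δ_k²` for `k ≥ k₀`. -/
noncomputable def oracleAlloc {K : ℕ} (a Δ : Fin K → ℝ) (T : ℝ) (k₀ k : Fin K) : ℝ :=
  if k < k₀ then 0 else (oracleGamma a Δ T k₀ + Real.log (a k * Δ k ^ 2)) / Δ k ^ 2

theorem Hfun_eq_sum_max {K : ℕ} {a Δ : Fin K → ℝ} (ha : ∀ k, 0 < a k) (hΔ : ∀ k, 0 < Δ k)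
    (hsorted : ∀ j k : Fin K, j ≤ k → a j * Δ j ^ 2 ≤ a k * Δ k ^ 2) (k : Fin K) :
    Hfun a Δ k = ∑ j, (1 / Δ j ^ 2) *
      max (Real.log (a j * Δ j ^ 2) - Real.log (a k * Δ k ^ 2)) 0 := by
  have hpos : ∀ i, 0 < a i * Δ i ^ 2 := fun i => mul_pos (ha i) (pow_pos (hΔ i) 2)
  rw [Hfun, Finset.sum_filter]
  refine Finset.sum_congr rfl fun j _ => ?_
  split_ifs with h
  · have := Real.log_le_log (hpos k) (hsorted k j h.le)
    rw [max_eq_left (by linarith), Real.log_div (hpos j).ne' (hpos k).ne']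
  · have := Real.log_le_log (hpos j) (hsorted j k (not_lt.mp h))
    rw [max_eq_right (by linarith), mul_zero]

theorem Hfun_antitone {K : ℕ} {a Δ : Fin K → ℝ} (ha : ∀ k, 0 < a k) (hΔ : ∀ k, 0 < Δ k)
    (hsorted : ∀ j k : Fin K, j ≤ k → a j * Δ j ^ 2 ≤ a k * Δ k ^ 2) :
    Antitone (Hfun a Δ) := by
  intro i k hik
  have := Real.log_le_log (mul_pos (ha i) (pow_pos (hΔ i) 2)) (hsorted i k hik)
  rw [Hfun_eq_sum_max ha hΔ hsorted, Hfun_eq_sum_max ha hΔ hsorted]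
  gcongr

theorem existsUnique_oracleCond {K : ℕ} (hK : 1 ≤ K) {T : ℝ} (hT : 0 < T)
    {a Δ : Fin K → ℝ} (ha : ∀ k, 0 < a k) (hΔ : ∀ k, 0 < Δ k)
    (hsorted : ∀ j k : Fin K, j ≤ k → a j * Δ j ^ 2 ≤ a k * Δ k ^ 2) :
    ∃! k₀ : Fin K, oracleCond a Δ T k₀ := by
  have hlast : Hfun a Δ ⟨K - 1, by omega⟩ < T := by
    rw [Hfun, Finset.filter_false_of_mem, Finset.sum_empty]
    · exact hT
    · intro j _ h
      rw [Fin.lt_def] at h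
      have := j.isLt
      simp only at h
      omega
  obtain ⟨k₀, hk₀, hmin⟩ := wellFounded_lt.has_min {k : Fin K | Hfun a Δ k < T} ⟨_, hlast⟩
  have hlt : ∀ k k' : Fin K, oracleCond a Δ T k → oracleCond a Δ T k' → ¬ k < k' := by
    intro k k' h h' hkk'
    rw [Fin.lt_def] at hkk'
    have hj := h'.2 ⟨k' - 1, by omega⟩ (by simp only; omega)
    have := Hfun_antitone ha hΔ hsorted
      (show k ≤ ⟨k' - 1, by omega⟩ by rw [Fin.le_def]; simp only; omega)
    linarith [h.1]
  have hcond : oracleCond a Δ T k₀ := by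
    refine ⟨hk₀, fun j hj => ?_⟩
    by_contra h
    exact hmin j (not_le.mp h) (by rw [Fin.lt_def]; omega)
  exact ⟨k₀, hcond, fun k hk =>
    le_antisymm (not_lt.mp (hlt _ _ hcond hk)) (not_lt.mp (hlt _ _ hk hcond))⟩

theorem sum_inv_sq_pos {K : ℕ} {Δ : Fin K → ℝ} (hΔ : ∀ k, 0 < Δ k) (k₀ : Fin K) :
    0 < ∑ j ∈ Finset.univ.filter (fun j => k₀ ≤ j), 1 / Δ j ^ 2 :=
  Finset.sum_pos (fun j _ => one_div_pos.mpr (pow_pos (hΔ j) 2)) ⟨k₀, by simp⟩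

theorem sum_oracleGamma_add_log {K : ℕ} (a : Fin K → ℝ) {Δ : Fin K → ℝ} (hΔ : ∀ k, 0 < Δ k)
    (T : ℝ) (k₀ : Fin K) :
    ∑ j ∈ Finset.univ.filter (fun j => k₀ ≤ j),
      (1 / Δ j ^ 2) * (oracleGamma a Δ T k₀ + Real.log (a j * Δ j ^ 2)) = T := by
  have h := div_mul_cancel₀ (T + ∑ j ∈ Finset.univ.filter (fun j => k₀ ≤ j),
      (1 / Δ j ^ 2) * Real.log (1 / (a j * Δ j ^ 2))) (sum_inv_sq_pos hΔ k₀).ne'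
  rw [← oracleGamma] at h
  simp only [one_div, Real.log_inv, mul_neg, Finset.sum_neg_distrib] at h
  simp only [one_div, mul_add, Finset.sum_add_distrib, ← Finset.sum_mul]
  linarith

theorem oracleGamma_add_log_mul {K : ℕ} {a Δ : Fin K → ℝ} (ha : ∀ k, 0 < a k)
    (hΔ : ∀ k, 0 < Δ k) (T : ℝ) (k₀ i : Fin K) :
    (oracleGamma a Δ T k₀ + Real.log (a i * Δ i ^ 2)) *
        ∑ j ∈ Finset.univ.filter (fun j => k₀ ≤ j), 1 / Δ j ^ 2 =
      T - ∑ j ∈ Finset.univ.filter (fun j => k₀ ≤ j),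
        (1 / Δ j ^ 2) * Real.log ((a j * Δ j ^ 2) / (a i * Δ i ^ 2)) := by
  have hpos : ∀ i, 0 < a i * Δ i ^ 2 := fun i => mul_pos (ha i) (pow_pos (hΔ i) 2)
  rw [eq_sub_iff_add_eq, Finset.mul_sum, ← Finset.sum_add_distrib]
  refine Eq.trans (Finset.sum_congr rfl fun j _ => ?_) (sum_oracleGamma_add_log a hΔ T k₀)
  rw [Real.log_div (hpos j).ne' (hpos i).ne']
  ring

theorem oracleGamma_add_log_pos {K : ℕ} {a Δ : Fin K → ℝ} (ha : ∀ k, 0 < a k)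
    (hΔ : ∀ k, 0 < Δ k) (hsorted : ∀ j k : Fin K, j ≤ k → a j * Δ j ^ 2 ≤ a k * Δ k ^ 2)
    {T : ℝ} {k₀ : Fin K} (h : oracleCond a Δ T k₀) {k : Fin K} (hk : k₀ ≤ k) :
    0 < oracleGamma a Δ T k₀ + Real.log (a k * Δ k ^ 2) := by
  have hpos : ∀ i, 0 < a i * Δ i ^ 2 := fun i => mul_pos (ha i) (pow_pos (hΔ i) 2)
  have hH : ∑ j ∈ Finset.univ.filter (fun j => k₀ ≤ j),
      (1 / Δ j ^ 2) * Real.log ((a j * Δ j ^ 2) / (a k₀ * Δ k₀ ^ 2)) = Hfun a Δ k₀ := by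
    rw [Hfun, Finset.sum_filter, Finset.sum_filter]
    refine Finset.sum_congr rfl fun j _ => ?_
    rcases lt_trichotomy k₀ j with hj | rfl | hj
    · simp [hj, hj.le]
    · simp [div_self (hpos k₀).ne']
    · simp [hj.not_ge, hj.not_gt]
  have hmul := oracleGamma_add_log_mul ha hΔ T k₀ k₀
  rw [hH] at hmul
  have hk₀ : 0 < oracleGamma a Δ T k₀ + Real.log (a k₀ * Δ k₀ ^ 2) :=
    pos_of_mul_pos_left (hmul ▸ sub_pos.mpr h.1) (sum_inv_sq_pos hΔ k₀).le
  linarith [Real.log_le_log (hpos k₀) (hsorted k₀ k hk)]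

theorem oracleGamma_add_log_nonpos {K : ℕ} {a Δ : Fin K → ℝ} (ha : ∀ k, 0 < a k)
    (hΔ : ∀ k, 0 < Δ k) (hsorted : ∀ j k : Fin K, j ≤ k → a j * Δ j ^ 2 ≤ a k * Δ k ^ 2)
    {T : ℝ} {k₀ : Fin K} (h : oracleCond a Δ T k₀) {k : Fin K} (hk : k < k₀) :
    oracleGamma a Δ T k₀ + Real.log (a k * Δ k ^ 2) ≤ 0 := by
  rw [Fin.lt_def] at hk
  obtain ⟨p, hp⟩ : ∃ p : Fin K, (p : ℕ) + 1 = k₀ :=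
    ⟨⟨k₀ - 1, by omega⟩, by simp only; omega⟩
  have hH : ∑ j ∈ Finset.univ.filter (fun j => k₀ ≤ j),
      (1 / Δ j ^ 2) * Real.log ((a j * Δ j ^ 2) / (a p * Δ p ^ 2)) = Hfun a Δ p := by
    rw [Hfun]
    congr 1
    ext j
    simp only [Finset.mem_filter, Finset.mem_univ, true_and, Fin.le_def, Fin.lt_def]
    omega
  have hmul := oracleGamma_add_log_mul ha hΔ T k₀ p
  rw [hH] at hmul
  have hp₀ : oracleGamma a Δ T k₀ + Real.log (a p * Δ p ^ 2) ≤ 0 := by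
    by_contra hcon
    have := mul_pos (not_le.mp hcon) (sum_inv_sq_pos hΔ k₀)
    linarith [h.2 p hp]
  linarith [Real.log_le_log (mul_pos (ha k) (pow_pos (hΔ k) 2))
    (hsorted k p (by rw [Fin.le_def]; omega))]

theorem sum_oracleAlloc {K : ℕ} (a : Fin K → ℝ) {Δ : Fin K → ℝ} (hΔ : ∀ k, 0 < Δ k)
    (T : ℝ) (k₀ : Fin K) : ∑ k, oracleAlloc a Δ T k₀ k = T := by
  refine Eq.trans ?_ (sum_oracleGamma_add_log a hΔ T k₀)
  rw [Finset.sum_filter]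
  refine Finset.sum_congr rfl fun k _ => ?_
  rw [oracleAlloc]
  rcases lt_or_ge k k₀ with hk | hk
  · simp [hk, hk.not_ge]
  · rw [if_neg hk.not_gt, if_pos hk]
    ring

/-- The tangent-line bound for `x ↦ c * exp (-(x * d))`. -/
theorem exp_neg_mul_tangent_le {c : ℝ} (hc : 0 ≤ c) (d x y : ℝ) :
    c * Real.exp (-(x * d)) - c * d * Real.exp (-(x * d)) * (y - x) ≤
      c * Real.exp (-(y * d)) := by
  have hexp : Real.exp (-(y * d)) = Real.exp (-(x * d)) * Real.exp (-((y - x) * d)) := by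
    rw [← Real.exp_add]
    ring_nf
  rw [hexp]
  have := mul_le_mul_of_nonneg_left (Real.add_one_le_exp (-((y - x) * d)))
    (mul_nonneg hc (Real.exp_pos (-(x * d))).le)
  linarith

/-- The slope at the oracle allocation is at most `exp (-γ)`, with equality on the support. -/
theorem oracleAlloc_slope_mul_le {K : ℕ} {a Δ : Fin K → ℝ} (ha : ∀ k, 0 < a k)
    (hΔ : ∀ k, 0 < Δ k) (hsorted : ∀ j k : Fin K, j ≤ k → a j * Δ j ^ 2 ≤ a k * Δ k ^ 2)
    {T : ℝ} {k₀ : Fin K} (h : oracleCond a Δ T k₀) (k : Fin K) {y : ℝ} (hy : 0 ≤ y) :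
    a k * Δ k ^ 2 * Real.exp (-(oracleAlloc a Δ T k₀ k * Δ k ^ 2)) *
        (y - oracleAlloc a Δ T k₀ k) ≤
      Real.exp (-oracleGamma a Δ T k₀) * (y - oracleAlloc a Δ T k₀ k) := by
  have hpos : 0 < a k * Δ k ^ 2 := mul_pos (ha k) (pow_pos (hΔ k) 2)
  rcases lt_or_ge k k₀ with hk | hk
  · have hle : a k * Δ k ^ 2 ≤ Real.exp (-oracleGamma a Δ T k₀) := by
      rw [← Real.log_le_iff_le_exp hpos]
      linarith [oracleGamma_add_log_nonpos ha hΔ hsorted h hk]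
    simp only [oracleAlloc, if_pos hk, zero_mul, neg_zero, Real.exp_zero, mul_one, sub_zero]
    exact mul_le_mul_of_nonneg_right hle hy
  · refine le_of_eq (congrArg (· * _) ?_)
    rw [oracleAlloc, if_neg hk.not_gt, div_mul_cancel₀ _ (pow_pos (hΔ k) 2).ne', neg_add,
      Real.exp_add, Real.exp_neg (Real.log _), Real.exp_log hpos,
      mul_left_comm, mul_inv_cancel₀ hpos.ne', mul_one]

/-- Characterization of the non-adaptive oracle allocation minimizing
`N ↦ ∑_k a_k·exp(−N_kΔ_k²)` over nonnegative allocations of total budget `T`. -/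
theorem stmt3 (K : ℕ) (hK : 1 ≤ K) (T : ℝ) (hT : 0 < T)
    (a Δ : Fin K → ℝ) (ha : ∀ k, 0 < a k) (hΔ : ∀ k, 0 < Δ k)
    (hsorted : ∀ j k : Fin K, j ≤ k → a j * Δ j ^ 2 ≤ a k * Δ k ^ 2) :
    (∃! k₀ : Fin K, oracleCond a Δ T k₀) ∧
      ∀ k₀ : Fin K, oracleCond a Δ T k₀ →
        (∀ k, 0 ≤ oracleAlloc a Δ T k₀ k) ∧
        (∑ k, oracleAlloc a Δ T k₀ k = T) ∧
        ∀ N : Fin K → ℝ, (∀ k, 0 ≤ N k) → ∑ k, N k = T →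
          ∑ k, a k * Real.exp (-(oracleAlloc a Δ T k₀ k * Δ k ^ 2)) ≤
            ∑ k, a k * Real.exp (-(N k * Δ k ^ 2)) := by
  refine ⟨existsUnique_oracleCond hK hT ha hΔ hsorted, fun k₀ h => ⟨fun k => ?_,
    sum_oracleAlloc a hΔ T k₀, fun N hN hNT => ?_⟩⟩
  · rw [oracleAlloc]
    split_ifs with hk
    · exact le_rfl
    · exact div_nonneg (oracleGamma_add_log_pos ha hΔ hsorted h (not_lt.mp hk)).le
        (sq_nonneg _)
  · have hsum : ∑ k, Real.exp (-oracleGamma a Δ T k₀) * (N k - oracleAlloc a Δ T k₀ k) = 0 := by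
      rw [← Finset.mul_sum, Finset.sum_sub_distrib, hNT, sum_oracleAlloc a hΔ T k₀, sub_self,
        mul_zero]
    rw [← sub_zero (∑ k, a k * Real.exp (-(oracleAlloc a Δ T k₀ k * Δ k ^ 2))), ← hsum,
      ← Finset.sum_sub_distrib]
    refine Finset.sum_le_sum fun k _ => ?_
    linarith [exp_neg_mul_tangent_le (ha k).le (Δ k ^ 2) (oracleAlloc a Δ T k₀ k) (N k),
      oracleAlloc_slope_mul_le ha hΔ hsorted h k (hN k)]
end

section
/- Let (i_t)_{t≥1} be an index-based pull sequence, C ∈ ℝ, and T ≥ 1. Assume that for every arm k there exists n ∈ ℕ with I_k(n) ≥ C, and let τ_k(C) = min{n ∈ ℕ : I_k(n) ≥ C}. Then the following equivalence holds: ( there exists t ∈ {0,1,…,T} such that I_k(N_{k,t}) ≥ C for every k ∈ {1,…,K} ) if and only if ∑_{k=1}^K τ_k(C) ≤ T. -/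
/-- Number of pulls of arm `k` during the first `t` rounds, for the pull sequence `i`
(where `i s` is the arm pulled at round `s+1`). -/
def cnt {K : ℕ} (i : ℕ → Fin K) (t : ℕ) (k : Fin K) : ℕ :=
  ((Finset.range t).filter fun s => i s = k).card

theorem sum_cnt {K : ℕ} (i : ℕ → Fin K) (t : ℕ) : ∑ k, cnt i t k = t := by
  simpa [cnt] using (Finset.card_eq_sum_card_fiberwise
    (s := Finset.range t) (t := Finset.univ) (f := i) (by simp)).symm

theorem cnt_succ {K : ℕ} (i : ℕ → Fin K) (t : ℕ) (k : Fin K) :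
    cnt i (t + 1) k = cnt i t k + if i t = k then 1 else 0 := by
  unfold cnt
  rw [Finset.range_add_one, Finset.filter_insert]
  split_ifs <;> simp

/-- As long as some index has been below `C` at every earlier time, no arm has been pulled more
often than it takes for its index to reach `C`. -/
theorem cnt_le_find {K : ℕ} (I : Fin K → ℕ → ℝ) (i : ℕ → Fin K)
    (hpull : ∀ t j, I (i t) (cnt i t (i t)) ≤ I j (cnt i t j))
    (C : ℝ) (hreach : ∀ k, ∃ n, C ≤ I k n) (t : ℕ)
    (hbelow : ∀ s < t, ∃ k, I k (cnt i s k) < C) (k : Fin K) :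
    cnt i t k ≤ Nat.find (hreach k) := by
  induction t with
  | zero => simp [cnt]
  | succ t ih =>
    have hle := ih fun s hs => hbelow s (by omega)
    rw [cnt_succ]
    split_ifs with hk
    · subst hk
      obtain ⟨j, hj⟩ := hbelow t (by omega)
      refine Nat.succ_le_of_lt (lt_of_le_of_ne hle fun heq => ?_)
      have hC := Nat.find_spec (hreach (i t))
      rw [← heq] at hC
      exact absurd (hC.trans (hpull t j)) (not_le.mpr hj)
    · exact hle

/-- For an index-based pull sequence, all indices exceed `C` at some time `t ∈ {0,…,T}`
if and only if `∑_k τ_k(C) ≤ T`, where `τ_k(C)` is the minimal number of pulls after which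
the index of arm `k` is at least `C`. -/
theorem stmt10 (K : ℕ) [NeZero K] (I : Fin K → ℕ → ℝ) (i : ℕ → Fin K)
    (hpull : ∀ t j, I (i t) (cnt i t (i t)) ≤ I j (cnt i t j))
    (C : ℝ) (T : ℕ) (hT : 1 ≤ T) (hreach : ∀ k, ∃ n, C ≤ I k n) :
    (∃ t ≤ T, ∀ k, C ≤ I k (cnt i t k)) ↔ ∑ k, Nat.find (hreach k) ≤ T := by
  constructor
  · rintro ⟨t, htT, ht⟩
    calc ∑ k, Nat.find (hreach k) ≤ ∑ k, cnt i t k :=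
          Finset.sum_le_sum fun k _ => Nat.find_min' (hreach k) (ht k)
      _ = t := sum_cnt i t
      _ ≤ T := htT
  · intro hsum
    by_contra! hbelow
    have hle := cnt_le_find I i hpull C hreach T fun s hs => hbelow s hs.le
    have heq := (Finset.sum_eq_sum_iff_of_le fun k _ => hle k).mp
      (le_antisymm (Finset.sum_le_sum fun k _ => hle k) (hsum.trans_eq (sum_cnt i T).symm))
    obtain ⟨k, hk⟩ := hbelow T le_rfl
    rw [heq k (Finset.mem_univ k)] at hk
    exact absurd (Nat.find_spec (hreach k)) (not_le.mpr hk)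
end

section
/- Let (i_t)_{t≥1} be an index-based pull sequence and T ≥ 1. Let t_max be the largest element of argmax_{t ∈ {1,…,T}} min_{k∈{1,…,K}} I_k(N_{k,t}). Then at most one arm is pulled strictly after time t_max; that is, there is at most one arm j ∈ {1,…,K} with N_{j,t_max} ≠ N_{j,T}, and N_{k,t_max} = N_{k,T} for all other arms k. -/
/-- Minimal index over the arms after `t` rounds. -/
noncomputable def minIdx {K : ℕ} [NeZero K] (I : Fin K → ℕ → ℝ) (i : ℕ → Fin K) (t : ℕ) : ℝ :=
  Finset.univ.inf' ⟨0, Finset.mem_univ 0⟩ fun k => I k (cnt i t k)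

/-- The largest element of `argmax_{t ∈ {1,…,T}} min_k I_k(N_{k,t})`. -/
noncomputable def lastArgmax {K : ℕ} [NeZero K] (I : Fin K → ℕ → ℝ) (i : ℕ → Fin K)
    (T : ℕ) (hT : 1 ≤ T) : ℕ :=
  letI : DecidablePred fun t => ∀ s ∈ Finset.Icc 1 T, minIdx I i s ≤ minIdx I i t :=
    fun _ => Classical.propDecidable _
  ((Finset.Icc 1 T).filter fun t => ∀ s ∈ Finset.Icc 1 T, minIdx I i s ≤ minIdx I i t).max'
    (by
      obtain ⟨b, hb, hmax⟩ := Finset.exists_max_image (Finset.Icc 1 T) (minIdx I i)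
        ⟨1, by simp [Finset.mem_Icc, hT]⟩
      exact ⟨b, Finset.mem_filter.2 ⟨hb, hmax⟩⟩)

theorem cnt_succ_of_ne {K : ℕ} (i : ℕ → Fin K) (t : ℕ) {k : Fin K} (h : i t ≠ k) :
    cnt i (t + 1) k = cnt i t k := by
  simp [cnt, Finset.range_add_one, Finset.filter_insert, h]

/-- An arm that is not pulled in rounds `m + 1, …, s` keeps its pull count. -/
theorem cnt_eq_of_forall_ne {K : ℕ} (i : ℕ → Fin K) {m s : ℕ} (hms : m ≤ s) {k : Fin K}
    (h : ∀ r, m ≤ r → r < s → i r ≠ k) : cnt i m k = cnt i s k := by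
  induction s, hms using Nat.le_induction with
  | base => rfl
  | succ s hms ih =>
    rw [cnt_succ_of_ne i s (h s hms s.lt_succ_self)]
    exact ih fun r hmr hrs => h r hmr (hrs.trans s.lt_succ_self)

theorem minIdx_le {K : ℕ} [NeZero K] (I : Fin K → ℕ → ℝ) (i : ℕ → Fin K) (t : ℕ) (k : Fin K) :
    minIdx I i t ≤ I k (cnt i t k) :=
  Finset.inf'_le _ (Finset.mem_univ k)

theorem minIdx_eq_pulled {K : ℕ} [NeZero K] {I : Fin K → ℕ → ℝ} {i : ℕ → Fin K}
    (hpull : ∀ t j, I (i t) (cnt i t (i t)) ≤ I j (cnt i t j)) (t : ℕ) :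
    minIdx I i t = I (i t) (cnt i t (i t)) :=
  le_antisymm (minIdx_le I i t (i t)) (Finset.le_inf' _ _ fun j _ => hpull t j)

theorem isGreatest_lastArgmax {K : ℕ} [NeZero K] (I : Fin K → ℕ → ℝ) (i : ℕ → Fin K)
    (T : ℕ) (hT : 1 ≤ T) :
    IsGreatest {t | t ∈ Finset.Icc 1 T ∧ ∀ s ∈ Finset.Icc 1 T, minIdx I i s ≤ minIdx I i t}
      (lastArgmax I i T hT) := by
  refine (congrArg (IsGreatest · _)
    (@Finset.coe_filter _ _ (fun _ => Classical.propDecidable _) _)).mp ?_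
  exact Finset.isGreatest_max' _ _

theorem minIdx_lt_minIdx_lastArgmax {K : ℕ} [NeZero K] (I : Fin K → ℕ → ℝ) (i : ℕ → Fin K)
    (T : ℕ) (hT : 1 ≤ T) {s : ℕ} (hs : lastArgmax I i T hT < s) (hsT : s ≤ T) :
    minIdx I i s < minIdx I i (lastArgmax I i T hT) := by
  by_contra! hle
  obtain ⟨⟨-, hmax⟩, hub⟩ := isGreatest_lastArgmax I i T hT
  have hs1 : 1 ≤ s := (Nat.zero_le _).trans_lt hs
  exact hs.not_ge (hub ⟨Finset.mem_Icc.2 ⟨hs1, hsT⟩, fun r hr => (hmax r hr).trans hle⟩)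

/-- If the minimal index stays below its value at time `m` until time `T`, every pull in
between is of the arm pulled first after `m`. -/
theorem pulled_eq_of_minIdx_lt {K : ℕ} [NeZero K] {I : Fin K → ℕ → ℝ} {i : ℕ → Fin K}
    (hpull : ∀ t j, I (i t) (cnt i t (i t)) ≤ I j (cnt i t j)) {m T : ℕ}
    (hlt : ∀ s, m < s → s ≤ T → minIdx I i s < minIdx I i m) (s : ℕ) (hms : m ≤ s)
    (hsT : s < T) : i s = i m := by
  induction s using Nat.strong_induction_on with
  | _ s ih =>
    rcases hms.eq_or_lt with rfl | hlt_s
    · rfl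
    by_contra hne
    have hcnt : cnt i m (i s) = cnt i s (i s) := cnt_eq_of_forall_ne i hms fun r hmr hrs heq =>
      hne (heq.symm.trans (ih r hrs hmr (hrs.trans hsT)))
    have hs := hlt s hlt_s hsT.le
    rw [minIdx_eq_pulled hpull s, ← hcnt] at hs
    exact hs.not_ge (minIdx_le I i m (i s))

/-- At most one arm is pulled strictly after the time `t_max` at which the minimal index
was last maximal: there is at most one arm whose pull count at `t_max` differs from its
pull count at `T`. -/
theorem stmt11 (K : ℕ) [NeZero K] (I : Fin K → ℕ → ℝ) (i : ℕ → Fin K)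
    (hpull : ∀ t j, I (i t) (cnt i t (i t)) ≤ I j (cnt i t j))
    (T : ℕ) (hT : 1 ≤ T) :
    ∀ j j' : Fin K, cnt i (lastArgmax I i T hT) j ≠ cnt i T j →
      cnt i (lastArgmax I i T hT) j' ≠ cnt i T j' → j = j' := by
  have pulled_of_ne : ∀ k, cnt i (lastArgmax I i T hT) k ≠ cnt i T k →
      i (lastArgmax I i T hT) = k := by
    intro k hk
    by_contra hne
    refine hk (cnt_eq_of_forall_ne i (Finset.mem_Icc.1 (isGreatest_lastArgmax I i T hT).1.1).2
      fun r hmr hrT heq => hne ?_)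
    rw [← heq]
    exact (pulled_eq_of_minIdx_lt hpull
      (fun s => minIdx_lt_minIdx_lastArgmax I i T hT) r hmr hrT).symm
  intro j j' hj hj'
  exact (pulled_of_ne j hj).symm.trans (pulled_of_ne j' hj')
end

section
/- Let σ > 0 and θ, μ, μ̂ ∈ ℝ with (μ̂ − θ)·(μ − θ) < 0. Set Δ = |μ − θ|/√(2σ²) and Δ̂ = |μ̂ − θ|/√(2σ²). Let N ≥ 0 and n₀ ≥ 0 be reals with N·(μ̂ − μ)² ≤ 2σ²·n₀·Δ², and let F : ℝ_{≥0} × ℝ_{≥0} → ℝ be nondecreasing in each argument with F(N, N·Δ̂²) ≥ C for some C ∈ ℝ. Then: (i) N ≤ n₀; (ii) N·Δ̂² ≤ (n₀ − N)·Δ², so that F(N, (n₀ − N)·Δ²) ≥ F(N, N·Δ̂²); and (iii) F(n₀, n₀·Δ²) ≥ C. -/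
/-- If the empirical mean `μhat` predicts the wrong sign relative to the true mean `μ`
(hypothesis `hmistake`) and the concentration event `N·(μhat−μ)² ≤ 2σ²·n₀·Δ²` holds, then
(i) `N ≤ n₀`, (ii) `N·Δ̂² ≤ (n₀−N)·Δ²` so that `F(N, (n₀−N)Δ²) ≥ F(N, N·Δ̂²)`, and
(iii) `F(n₀, n₀Δ²) ≥ C`. -/
theorem stmt16 (σ θ μ μhat : ℝ) (hσ : 0 < σ)
    (hmistake : (μhat - θ) * (μ - θ) < 0)
    (Δ Δhat : ℝ) (hΔ : Δ = |μ - θ| / Real.sqrt (2 * σ ^ 2))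
    (hΔhat : Δhat = |μhat - θ| / Real.sqrt (2 * σ ^ 2))
    (N n₀ : ℝ) (hN : 0 ≤ N) (hn₀ : 0 ≤ n₀)
    (hconc : N * (μhat - μ) ^ 2 ≤ 2 * σ ^ 2 * n₀ * Δ ^ 2)
    (F : ℝ → ℝ → ℝ)
    (hFn : ∀ x, 0 ≤ x → MonotoneOn (fun n => F n x) (Set.Ici 0))
    (hFx : ∀ n, 0 ≤ n → MonotoneOn (fun x => F n x) (Set.Ici 0))
    (C : ℝ) (hC : C ≤ F N (N * Δhat ^ 2)) :
    N ≤ n₀ ∧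
      (N * Δhat ^ 2 ≤ (n₀ - N) * Δ ^ 2 ∧
        F N (N * Δhat ^ 2) ≤ F N ((n₀ - N) * Δ ^ 2)) ∧
      C ≤ F n₀ (n₀ * Δ ^ 2) := by
  have hs : 0 < 2 * σ ^ 2 := by positivity
  have hμ : μ - θ ≠ 0 := right_ne_zero_of_mul hmistake.ne
  have hΔsq : Δ ^ 2 * (2 * σ ^ 2) = (μ - θ) ^ 2 := by
    rw [hΔ, div_pow, sq_abs, Real.sq_sqrt hs.le, div_mul_cancel₀ _ hs.ne']
  have hΔhatsq : Δhat ^ 2 * (2 * σ ^ 2) = (μhat - θ) ^ 2 := by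
    rw [hΔhat, div_pow, sq_abs, Real.sq_sqrt hs.le, div_mul_cancel₀ _ hs.ne']
  have hΔpos : 0 < Δ ^ 2 :=
    pos_of_mul_pos_left (hΔsq ▸ sq_pos_of_ne_zero hμ) hs.le
  have hgap : (μhat - θ) ^ 2 + (μ - θ) ^ 2 ≤ (μhat - μ) ^ 2 := by
    linarith [show (μhat - μ) ^ 2 =
      (μhat - θ) ^ 2 + (μ - θ) ^ 2 - 2 * ((μhat - θ) * (μ - θ)) by ring]
  have hle : N * Δhat ^ 2 ≤ (n₀ - N) * Δ ^ 2 := by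
    refine le_of_mul_le_mul_right ?_ hs
    have h := (mul_le_mul_of_nonneg_left hgap hN).trans hconc
    rw [← hΔsq, ← hΔhatsq] at h
    linarith
  have hnonneg : 0 ≤ N * Δhat ^ 2 := by positivity
  have hNn₀ : N ≤ n₀ :=
    sub_nonneg.mp (nonneg_of_mul_nonneg_left (hnonneg.trans hle) hΔpos)
  have hF := hFx N hN hnonneg (hnonneg.trans hle) hle
  have hn₀Δ : 0 ≤ n₀ * Δ ^ 2 := by positivity
  have hle' : (n₀ - N) * Δ ^ 2 ≤ n₀ * Δ ^ 2 := by
    gcongr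
    linarith
  exact ⟨hNn₀, ⟨hle, hF⟩, hC.trans <| hF.trans <|
    (hFx N hN (hnonneg.trans hle) hn₀Δ hle').trans (hFn _ hn₀Δ hN hn₀ hNn₀)⟩
end
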